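/- arXiv:1709.06695 — 2 statements merged into one kernel-verified Lean document; each statement's English description precedes it below -/
import Mathlib

section
/- Let f : [0,1]^2 → ℝ be such that the mixed partial derivative ∂²f/∂x₁∂x₂ is continuous, and suppose ∫_0^1 f(x₁,x₂) dx₁ = 0 for all x₂ and ∫_0^1 f(x₁,x₂) dx₂ = 0 for all x₁. Then ∫_{[0,1]^2} (∂²f/∂x₁∂x₂)² dx ≥ π^4 ∫_{[0,1]^2} f² dx. -/
open Real

lemma dirichlet_aux (u g : ℝ → ℝ) (hu : ∀ x, HasDerivAt u (g x) x) (hg : Continuous g)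
    (h0 : u 0 = 0) (h1 : u 1 = 0) (l : ℝ) (hl0 : 0 < l) (hl : l < π) :
    l ^ 2 * ∫ x in (0:ℝ)..1, u x ^ 2 ≤ ∫ x in (0:ℝ)..1, g x ^ 2 := by
  have huc : Continuous u := continuous_iff_continuousAt.2 fun x => (hu x).continuousAt
  have hcos : ∀ x ∈ Set.Icc (0:ℝ) 1, cos (l * (x - 1/2)) ≠ 0 := by
    intro x hx
    apply ne_of_gt
    apply cos_pos_of_mem_Ioo
    constructor <;> nlinarith [hx.1, hx.2]
  set W' : ℝ → ℝ := fun x => l * (1 / cos (l * (x - 1/2)) ^ 2 * l) * u x ^ 2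
    + l * tan (l * (x - 1/2)) * (2 * u x * g x) with hW'
  have hder : ∀ x ∈ Set.uIcc (0:ℝ) 1,
      HasDerivAt (fun x => l * tan (l * (x - 1/2)) * u x ^ 2) (W' x) x := by
    intro x hx
    rw [Set.uIcc_of_le zero_le_one] at hx
    have h2 : HasDerivAt (fun x : ℝ => l * (x - 1/2)) l x := by
      have := ((hasDerivAt_id x).sub_const (1/2)).const_mul l
      rw [mul_one] at this
      exact this
    have h3 := ((hasDerivAt_tan (hcos x hx)).comp x h2).const_mul l
    have h4 := h3.mul ((hu x).pow 2)
    refine h4.congr_deriv ?_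
    simp only [hW', Function.comp]
    simp
  have hcc : ContinuousOn W' (Set.uIcc (0:ℝ) 1) := by
    rw [Set.uIcc_of_le zero_le_one]
    have e : W' = fun x => l * (1 / cos (l * (x - 1/2)) ^ 2 * l) * u x ^ 2
        + l * (sin (l * (x - 1/2)) / cos (l * (x - 1/2))) * (2 * u x * g x) := by
      funext x; simp only [hW', tan_eq_sin_div_cos]
    rw [e]
    apply ContinuousOn.add
    · refine ContinuousOn.mul (ContinuousOn.mul continuousOn_const (ContinuousOn.mul
        (ContinuousOn.div continuousOn_const (by fun_prop) ?_) continuousOn_const)) (by fun_prop)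
      intro x hx; exact pow_ne_zero _ (hcos x hx)
    · refine ContinuousOn.mul (ContinuousOn.mul continuousOn_const
        (ContinuousOn.div (by fun_prop) (by fun_prop) hcos)) (by fun_prop)
  have hFTC := intervalIntegral.integral_eq_sub_of_hasDerivAt hder hcc.intervalIntegrable
  have hmono : ∫ x in (0:ℝ)..1, (l ^ 2 * u x ^ 2 - g x ^ 2) ≤ ∫ x in (0:ℝ)..1, W' x := by
    apply intervalIntegral.integral_mono_on zero_le_one
    · exact Continuous.intervalIntegrable (by fun_prop) _ _
    · exact hcc.intervalIntegrable
    · intro x hx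
      have hc := hcos x hx
      have : 1 / cos (l * (x - 1/2)) ^ 2 = 1 + tan (l * (x - 1/2)) ^ 2 := by
        rw [tan_eq_sin_div_cos]; rw [div_pow, eq_comm, ← sub_eq_zero]
        have hc2 : cos (l * (x - 1/2)) ^ 2 ≠ 0 := pow_ne_zero _ hc
        rw [sin_sq, sub_div, div_self hc2]; ring
      simp only [hW', this]
      nlinarith [sq_nonneg (g x + l * tan (l * (x - 1/2)) * u x)]
  rw [hFTC, intervalIntegral.integral_sub (Continuous.intervalIntegrable (by fun_prop) _ _)
    (Continuous.intervalIntegrable (by fun_prop) _ _), intervalIntegral.integral_const_mul] at hmono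
  simp only [h0, h1] at hmono
  linarith

lemma dirichlet (u g : ℝ → ℝ) (hu : ∀ x, HasDerivAt u (g x) x) (hg : Continuous g)
    (h0 : u 0 = 0) (h1 : u 1 = 0) :
    π ^ 2 * ∫ x in (0:ℝ)..1, u x ^ 2 ≤ ∫ x in (0:ℝ)..1, g x ^ 2 := by
  have ht : Filter.Tendsto (fun l : ℝ => l ^ 2 * ∫ x in (0:ℝ)..1, u x ^ 2) (nhdsWithin π (Set.Iio π))
      (nhds (π ^ 2 * ∫ x in (0:ℝ)..1, u x ^ 2)) :=
    Filter.Tendsto.mono_left (Continuous.tendsto (by fun_prop) π) nhdsWithin_le_nhds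
  refine le_of_tendsto ht ?_
  filter_upwards [Ioo_mem_nhdsLT pi_pos] with l hl
  exact dirichlet_aux u g hu hg h0 h1 l hl.1 hl.2

lemma prim_deriv (g : ℝ → ℝ) (hg : Continuous g) (a x : ℝ) :
    HasDerivAt (fun x => ∫ t in a..x, g t) (g x) x :=
  intervalIntegral.integral_hasDerivAt_right (hg.intervalIntegrable _ _)
    hg.stronglyMeasurable.stronglyMeasurableAtFilter hg.continuousAt

lemma wirtinger (g p : ℝ → ℝ) (hgp : ∀ x, HasDerivAt g (p x) x) (hp : Continuous p)
    (hm : ∫ x in (0:ℝ)..1, g x = 0) :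
    π ^ 2 * ∫ x in (0:ℝ)..1, g x ^ 2 ≤ ∫ x in (0:ℝ)..1, p x ^ 2 := by
  have hg : Continuous g := continuous_iff_continuousAt.2 fun x => (hgp x).continuousAt
  set u : ℝ → ℝ := fun x => ∫ t in (0:ℝ)..x, g t with hu
  have hud : ∀ x, HasDerivAt u (g x) x := fun x => prim_deriv g hg 0 x
  have huc : Continuous u := continuous_iff_continuousAt.2 fun x => (hud x).continuousAt
  have h0 : u 0 = 0 := by simp [hu]
  have h1 : u 1 = 0 := hm
  have hD := dirichlet u g hud hg h0 h1
  have hparts := intervalIntegral.integral_mul_deriv_eq_deriv_mul (a := 0) (b := 1)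
    (fun x _ => hud x) (fun x _ => hgp x) (hg.intervalIntegrable _ _) (hp.intervalIntegrable _ _)
  rw [h0, h1] at hparts
  have hnn : 0 ≤ ∫ x in (0:ℝ)..1, (p x + π ^ 2 * u x) ^ 2 :=
    intervalIntegral.integral_nonneg zero_le_one fun x _ => sq_nonneg _
  have e : (fun x => (p x + π ^ 2 * u x) ^ 2)
      = fun x => p x ^ 2 + 2 * π ^ 2 * (u x * p x) + π ^ 4 * u x ^ 2 := by
    funext x; ring
  have e2 : ∀ x, g x * g x = g x ^ 2 := fun x => by ring
  simp only [e2] at hparts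
  rw [e, intervalIntegral.integral_add (Continuous.intervalIntegrable (by fun_prop) _ _)
    (Continuous.intervalIntegrable (by fun_prop) _ _),
    intervalIntegral.integral_add (Continuous.intervalIntegrable (by fun_prop) _ _)
    (Continuous.intervalIntegrable (by fun_prop) _ _), intervalIntegral.integral_const_mul,
    intervalIntegral.integral_const_mul, hparts] at hnn
  nlinarith [mul_le_mul_of_nonneg_left hD (sq_nonneg π)]

lemma swap01 (h : ℝ → ℝ → ℝ) (hh : Continuous (fun p : ℝ × ℝ => h p.1 p.2)) (a b c d : ℝ) :
    ∫ x in a..b, ∫ y in c..d, h x y = ∫ y in c..d, ∫ x in a..b, h x y := by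
  apply MeasureTheory.intervalIntegral_intervalIntegral_swap
  have h1 : MeasureTheory.IntegrableOn (Function.uncurry h) (Set.uIcc a b ×ˢ Set.uIcc c d) :=
    ContinuousOn.integrableOn_compact (isCompact_uIcc.prod isCompact_uIcc) hh.continuousOn
  exact h1.mono_set (Set.prod_mono Set.uIoc_subset_uIcc Set.uIoc_subset_uIcc)

/-- Two-dimensional Poincaré-type inequality: if `f : [0,1]² → ℝ` has continuous mixed
partial derivative `f₁₂ = ∂²f/∂x₁∂x₂` and both one-dimensional averages of `f` vanish,
then `∫∫ f₁₂² ≥ π⁴ ∫∫ f²`. -/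
theorem poincare_two_dim (f f₁ f₁₂ : ℝ → ℝ → ℝ)
    (hd1 : ∀ x y : ℝ, HasDerivAt (fun s => f s y) (f₁ x y) x)
    (hd2 : ∀ x y : ℝ, HasDerivAt (fun t => f₁ x t) (f₁₂ x y) y)
    (hcont : ContinuousOn (fun p : ℝ × ℝ => f₁₂ p.1 p.2)
      (Set.Icc (0:ℝ) 1 ×ˢ Set.Icc (0:ℝ) 1))
    (hmean1 : ∀ y : ℝ, ∫ x in (0:ℝ)..1, f x y = 0)
    (hmean2 : ∀ x : ℝ, ∫ y in (0:ℝ)..1, f x y = 0) :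
    ∫ x in (0:ℝ)..1, ∫ y in (0:ℝ)..1, (f₁₂ x y) ^ 2 ≥
      π ^ 4 * ∫ x in (0:ℝ)..1, ∫ y in (0:ℝ)..1, (f x y) ^ 2 := by
  have hI01 : Set.uIcc (0:ℝ) 1 = Set.Icc 0 1 := Set.uIcc_of_le zero_le_one
  -- continuous extension of the mixed derivative
  obtain ⟨k, hk, hkeq⟩ : ∃ k : ℝ → ℝ → ℝ, Continuous (fun p : ℝ × ℝ => k p.1 p.2) ∧
      ∀ x ∈ Set.Icc (0:ℝ) 1, ∀ y ∈ Set.Icc (0:ℝ) 1, k x y = f₁₂ x y := by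
    refine ⟨fun x y => f₁₂ (Set.projIcc 0 1 zero_le_one x : ℝ) (Set.projIcc 0 1 zero_le_one y : ℝ),
      ?_, ?_⟩
    · have hc : Continuous (fun p : ℝ × ℝ => (((Set.projIcc 0 1 zero_le_one p.1 : Set.Icc (0:ℝ) 1) : ℝ),
          ((Set.projIcc 0 1 zero_le_one p.2 : Set.Icc (0:ℝ) 1) : ℝ))) :=
        ((continuous_subtype_val.comp (continuous_projIcc.comp continuous_fst))).prodMk
          (continuous_subtype_val.comp (continuous_projIcc.comp continuous_snd))
      exact hcont.comp_continuous hc fun p => ⟨Subtype.property _, Subtype.property _⟩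
    · intro x hx y hy
      simp only [Set.projIcc_of_mem zero_le_one hx, Set.projIcc_of_mem zero_le_one hy]
  have hkx : ∀ x, Continuous (k x) := fun x => hk.comp (Continuous.prodMk_right x)
  -- primitives
  obtain ⟨K, hKdef⟩ : ∃ K : ℝ → ℝ → ℝ, ∀ x y, K x y = ∫ t in (0:ℝ)..y, k x t :=
    ⟨_, fun _ _ => rfl⟩
  have hK : Continuous (fun p : ℝ × ℝ => K p.1 p.2) := by
    simp only [hKdef]
    exact intervalIntegral.continuous_parametric_intervalIntegral_of_continuous
      (f := fun (p : ℝ × ℝ) t => k p.1 t)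
      (hk.comp ((continuous_fst.comp continuous_fst).prodMk continuous_snd)) continuous_snd
  have hKx : ∀ x, Continuous (K x) := fun x => hK.comp (Continuous.prodMk_right x)
  have hKy : ∀ y, Continuous (fun x => K x y) := fun y => hK.comp (Continuous.prodMk_left y)
  have hKd : ∀ x y, HasDerivAt (K x) (k x y) y := by
    intro x y
    have := prim_deriv (k x) (hkx x) 0 y
    rwa [← funext (hKdef x)] at this
  obtain ⟨J, hJdef⟩ : ∃ J : ℝ → ℝ → ℝ, ∀ x y, J x y = ∫ s in (0:ℝ)..x, K s y :=
    ⟨_, fun _ _ => rfl⟩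
  have hJ : Continuous (fun p : ℝ × ℝ => J p.1 p.2) := by
    simp only [hJdef]
    exact intervalIntegral.continuous_parametric_intervalIntegral_of_continuous
      (f := fun (p : ℝ × ℝ) t => K t p.2)
      (hK.comp (continuous_snd.prodMk (continuous_snd.comp continuous_fst))) continuous_fst
  have hJx : ∀ x, Continuous (J x) := fun x => hJ.comp (Continuous.prodMk_right x)
  have hJy : ∀ y, Continuous (fun x => J x y) := fun y => hJ.comp (Continuous.prodMk_left y)
  have hJd : ∀ x y, HasDerivAt (fun s => J s y) (K x y) x := by
    intro x y
    have := prim_deriv (fun s => K s y) (hKy y) 0 x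
    rwa [← funext (fun s => hJdef s y)] at this
  obtain ⟨A, hA⟩ : ∃ A : ℝ → ℝ, ∀ y, A y = ∫ x in (0:ℝ)..1, J x y := ⟨_, fun _ => rfl⟩
  have hAc : Continuous A := by
    rw [funext hA]
    exact intervalIntegral.continuous_parametric_intervalIntegral_of_continuous'
      (f := fun y x => J x y) (hJ.comp (continuous_snd.prodMk continuous_fst)) 0 1
  obtain ⟨M, hM⟩ : ∃ M : ℝ → ℝ, ∀ x, M x = ∫ y in (0:ℝ)..1, K x y := ⟨_, fun _ => rfl⟩
  have hMc : Continuous M := by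
    rw [funext hM]
    exact intervalIntegral.continuous_parametric_intervalIntegral_of_continuous'
      (f := fun x y => K x y) hK 0 1
  obtain ⟨B, hB⟩ : ∃ B : ℝ → ℝ, ∀ x, B x = ∫ s in (0:ℝ)..x, M s := ⟨_, fun _ => rfl⟩
  have hBd : ∀ x, HasDerivAt B (M x) x := by
    intro x
    have := prim_deriv M hMc 0 x
    rwa [← funext hB] at this
  have hBc : Continuous B := continuous_iff_continuousAt.2 fun x => (hBd x).continuousAt
  have hBJ : ∀ x, ∫ y in (0:ℝ)..1, J x y = B x := by
    intro x
    rw [hB]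
    simp only [hJdef, hM]
    exact (swap01 K hK 0 x 0 1).symm
  -- representation of f
  have h0 : (0:ℝ) ∈ Set.Icc (0:ℝ) 1 := ⟨le_rfl, zero_le_one⟩
  have step1 : ∀ x ∈ Set.Icc (0:ℝ) 1, ∀ y ∈ Set.Icc (0:ℝ) 1, K x y = f₁ x y - f₁ x 0 := by
    intro x hx y hy
    rw [hKdef]
    apply intervalIntegral.integral_eq_sub_of_hasDerivAt (f := fun t => f₁ x t)
    · intro t ht
      rw [Set.uIcc_of_le hy.1] at ht
      rw [hkeq x hx t ⟨ht.1, ht.2.trans hy.2⟩]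
      exact hd2 x t
    · exact (hkx x).intervalIntegrable _ _
  have step2 : ∀ x ∈ Set.Icc (0:ℝ) 1, ∀ y ∈ Set.Icc (0:ℝ) 1,
      J x y = (f x y - f x 0) - (f 0 y - f 0 0) := by
    intro x hx y hy
    rw [hJdef]
    apply intervalIntegral.integral_eq_sub_of_hasDerivAt (f := fun s => f s y - f s 0)
    · intro s hs
      rw [Set.uIcc_of_le hx.1] at hs
      rw [step1 s ⟨hs.1, hs.2.trans hx.2⟩ y hy]
      exact (hd1 s y).sub (hd1 s 0)
    · exact (hKy y).intervalIntegrable _ _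
  have hfc : ∀ y, Continuous (fun x => f x y) := fun y =>
    continuous_iff_continuousAt.2 fun x => (hd1 x y).continuousAt
  have step3 : ∀ y ∈ Set.Icc (0:ℝ) 1, A y = -(f 0 y - f 0 0) := by
    intro y hy
    have e : A y = ∫ x in (0:ℝ)..1, ((f x y - f x 0) - (f 0 y - f 0 0)) := by
      rw [hA]
      apply intervalIntegral.integral_congr
      intro x hx
      rw [hI01] at hx
      exact step2 x hx y hy
    rw [e, intervalIntegral.integral_sub
      (Continuous.intervalIntegrable ((hfc y).fun_sub (hfc 0)) _ _) intervalIntegrable_const,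
      intervalIntegral.integral_sub ((hfc y).intervalIntegrable _ _)
      ((hfc 0).intervalIntegrable _ _), hmean1, hmean1]
    simp
  obtain ⟨C, hC⟩ : ∃ C : ℝ, C = ∫ y in (0:ℝ)..1, A y := ⟨_, rfl⟩
  have step4 : ∀ x ∈ Set.Icc (0:ℝ) 1, f x 0 = C - B x := by
    intro x hx
    have e : ∫ y in (0:ℝ)..1, f x y = ∫ y in (0:ℝ)..1, (f x 0 - A y + J x y) := by
      apply intervalIntegral.integral_congr
      intro y hy
      rw [hI01] at hy
      simp only
      rw [step2 x hx y hy, step3 y hy]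
      ring
    rw [hmean2, intervalIntegral.integral_add
      ((continuous_const.fun_sub hAc).intervalIntegrable _ _) ((hJx x).intervalIntegrable _ _),
      intervalIntegral.integral_sub intervalIntegrable_const (hAc.intervalIntegrable _ _),
      hBJ, ← hC] at e
    simp at e
    linarith
  obtain ⟨F, hF⟩ : ∃ F : ℝ → ℝ → ℝ, ∀ x y, F x y = C - B x - A y + J x y := ⟨_, fun _ _ => rfl⟩
  have hFf : ∀ x ∈ Set.Icc (0:ℝ) 1, ∀ y ∈ Set.Icc (0:ℝ) 1, f x y = F x y := by
    intro x hx y hy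
    rw [hF, ← step4 x hx, step3 y hy, step2 x hx y hy]
    ring
  have hFc : Continuous (fun p : ℝ × ℝ => F p.1 p.2) := by
    simp only [hF]
    fun_prop
  obtain ⟨P, hP⟩ : ∃ P : ℝ → ℝ → ℝ, ∀ x y, P x y = K x y - M x := ⟨_, fun _ _ => rfl⟩
  have hPc : Continuous (fun p : ℝ × ℝ => P p.1 p.2) := by
    simp only [hP]
    fun_prop
  -- inequality in the first variable
  have ineq1 : ∀ y ∈ Set.Icc (0:ℝ) 1,
      π ^ 2 * ∫ x in (0:ℝ)..1, F x y ^ 2 ≤ ∫ x in (0:ℝ)..1, P x y ^ 2 := by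
    intro y hy
    apply wirtinger (fun x => F x y) (fun x => P x y)
    · intro x
      simp only [hF, hP]
      exact ((((hBd x).const_sub C).sub_const (A y)).add (hJd x y)).congr_deriv (by ring)
    · exact hPc.comp (Continuous.prodMk_left y)
    · refine Eq.trans ?_ (hmean1 y)
      apply intervalIntegral.integral_congr
      intro x hx
      rw [hI01] at hx
      exact (hFf x hx y hy).symm
  -- inequality in the second variable
  have ineq2 : ∀ x, π ^ 2 * ∫ y in (0:ℝ)..1, P x y ^ 2 ≤ ∫ y in (0:ℝ)..1, k x y ^ 2 := by
    intro x
    apply wirtinger (P x) (k x)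
    · intro y
      rw [funext (hP x)]
      exact (hKd x y).sub_const _
    · exact hkx x
    · simp only [hP]
      rw [intervalIntegral.integral_sub ((hKx x).intervalIntegrable _ _) intervalIntegrable_const,
        ← hM]
      simp
  have hF2 : Continuous (fun p : ℝ × ℝ => F p.1 p.2 ^ 2) := hFc.pow 2
  have hP2 : Continuous (fun p : ℝ × ℝ => P p.1 p.2 ^ 2) := hPc.pow 2
  have hk2 : Continuous (fun p : ℝ × ℝ => k p.1 p.2 ^ 2) := hk.pow 2
  have par1 : ∀ h : ℝ → ℝ → ℝ, Continuous (fun p : ℝ × ℝ => h p.1 p.2) →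
      Continuous (fun x => ∫ y in (0:ℝ)..1, h x y) := fun h hh =>
    intervalIntegral.continuous_parametric_intervalIntegral_of_continuous' (f := h) hh 0 1
  have par2 : ∀ h : ℝ → ℝ → ℝ, Continuous (fun p : ℝ × ℝ => h p.1 p.2) →
      Continuous (fun y => ∫ x in (0:ℝ)..1, h x y) := fun h hh =>
    par1 (fun y x => h x y) (hh.comp (continuous_snd.prodMk continuous_fst))
  have I1 : π ^ 2 * ∫ y in (0:ℝ)..1, ∫ x in (0:ℝ)..1, F x y ^ 2 ≤
      ∫ y in (0:ℝ)..1, ∫ x in (0:ℝ)..1, P x y ^ 2 := by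
    rw [← intervalIntegral.integral_const_mul]
    exact intervalIntegral.integral_mono_on zero_le_one
      ((continuous_const.mul (par2 (fun x y => F x y ^ 2) hF2)).intervalIntegrable _ _)
      ((par2 (fun x y => P x y ^ 2) hP2).intervalIntegrable _ _) ineq1
  have I2 : π ^ 2 * ∫ x in (0:ℝ)..1, ∫ y in (0:ℝ)..1, P x y ^ 2 ≤
      ∫ x in (0:ℝ)..1, ∫ y in (0:ℝ)..1, k x y ^ 2 := by
    rw [← intervalIntegral.integral_const_mul]
    exact intervalIntegral.integral_mono_on zero_le_one
      ((continuous_const.mul (par1 (fun x y => P x y ^ 2) hP2)).intervalIntegrable _ _)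
      ((par1 (fun x y => k x y ^ 2) hk2).intervalIntegrable _ _) fun x _ => ineq2 x
  rw [← swap01 (fun x y => F x y ^ 2) hF2, ← swap01 (fun x y => P x y ^ 2) hP2] at I1
  have E1 : ∫ x in (0:ℝ)..1, ∫ y in (0:ℝ)..1, (f x y) ^ 2 =
      ∫ x in (0:ℝ)..1, ∫ y in (0:ℝ)..1, F x y ^ 2 := by
    apply intervalIntegral.integral_congr
    intro x hx
    apply intervalIntegral.integral_congr
    intro y hy
    rw [hI01] at hx hy
    simp only [hFf x hx y hy]
  have E2 : ∫ x in (0:ℝ)..1, ∫ y in (0:ℝ)..1, (f₁₂ x y) ^ 2 =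
      ∫ x in (0:ℝ)..1, ∫ y in (0:ℝ)..1, k x y ^ 2 := by
    apply intervalIntegral.integral_congr
    intro x hx
    apply intervalIntegral.integral_congr
    intro y hy
    rw [hI01] at hx hy
    simp only [hkeq x hx y hy]
  rw [E1, E2, ge_iff_le]
  nlinarith [mul_le_mul_of_nonneg_left I1 (sq_nonneg π)]
end

section
/- Let d ≥ r ≥ 0 and let f : [0,1]^d → ℝ satisfy ∫_0^1 f(x) dx_j = 0 for every j = 1,…,d (as a function of the other coordinates), and suppose the mixed partial derivative ∂^r f/∂x₁⋯∂x_r exists and is continuous. Then ∫_{[0,1]^d} (∂^r f/∂x₁⋯∂x_r)² dx ≥ π^{2r} ∫_{[0,1]^d} f² dx. -/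
open MeasureTheory Real Finset

noncomputable section

/-- The unit cube `[0,1]^d`. -/
def cube (d : ℕ) : Set (Fin d → ℝ) := Set.univ.pi fun _ => Set.Icc (0:ℝ) 1

/-- Partial derivative of `g` with respect to coordinate `j`. -/
def pderiv {d : ℕ} (j : Fin d) (g : (Fin d → ℝ) → ℝ) : (Fin d → ℝ) → ℝ :=
  fun x => deriv (fun t => g (Function.update x j t)) (x j)

/-- Mixed partial derivative `∂^u g`, one derivative for each coordinate in `u`. -/
def mderiv {d : ℕ} (u : Finset (Fin d)) (g : (Fin d → ℝ) → ℝ) : (Fin d → ℝ) → ℝ :=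
  u.toList.foldr pderiv g

/-- `margOut u g x = ∫ g dx_{-u}` : integral over the coordinates outside `u`. -/
def margOut {d : ℕ} (u : Finset (Fin d)) (g : (Fin d → ℝ) → ℝ) : (Fin d → ℝ) → ℝ :=
  fun x => ∫ z in cube d, g (fun j => if j ∈ u then x j else z j)

/-- All mixed partial derivatives of `f` exist and are continuous
(the paper's condition that `∂^{1:d} f` is continuous). -/
def SmoothEnough {d : ℕ} (f : (Fin d → ℝ) → ℝ) : Prop :=
  (∀ (v : Finset (Fin d)) (j : Fin d) (x : Fin d → ℝ),
      DifferentiableAt ℝ (fun t => mderiv v f (Function.update x j t)) (x j)) ∧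
  ∀ v : Finset (Fin d), Continuous (mderiv v f)

/-- Squared unanchored weighted Sobolev norm `‖f‖_γ²`. -/
def wnorm2 {d : ℕ} (γ : Finset (Fin d) → ℝ) (f : (Fin d → ℝ) → ℝ) : ℝ :=
  ∑ u : Finset (Fin d), (γ u)⁻¹ * ∫ x in cube d, (margOut u (mderiv u f) x) ^ 2

/-- `F` is the ANOVA decomposition of `f`: `f = ∑_u F u`, each `F u` depends only on
the coordinates in `u`, and `∫_0^1 F u dx_j = 0` for every `j ∈ u`. -/
def IsANOVA {d : ℕ} (f : (Fin d → ℝ) → ℝ)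
    (F : Finset (Fin d) → (Fin d → ℝ) → ℝ) : Prop :=
  (∀ x, f x = ∑ u : Finset (Fin d), F u x) ∧
  (∀ u : Finset (Fin d), ∀ x y : Fin d → ℝ, (∀ j ∈ u, x j = y j) → F u x = F u y) ∧
  (∀ u : Finset (Fin d), ∀ j ∈ u, ∀ x : Fin d → ℝ,
      ∫ t in (0:ℝ)..1, F u (Function.update x j t) = 0)

/-- ANOVA variance component `σ_u² = ∫ f_u²`. -/
def sigma2 {d : ℕ} (F : Finset (Fin d) → (Fin d → ℝ) → ℝ) (u : Finset (Fin d)) : ℝ :=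
  ∫ x in cube d, (F u x) ^ 2

/-- Mean `μ = ∫ f`. -/
def fmean {d : ℕ} (f : (Fin d → ℝ) → ℝ) : ℝ := ∫ x in cube d, f x

/-- Variance `σ²(f) = ∫ (f - μ)²`. -/
def fvar {d : ℕ} (f : (Fin d → ℝ) → ℝ) : ℝ := ∫ x in cube d, (f x - fmean f) ^ 2

/-- The critical radius `ρ*(γ)`: the smallest radius of a `γ`-ball containing a
function of unit variance. -/
def rhoStar {d : ℕ} (γ : Finset (Fin d) → ℝ) : ℝ :=
  sInf {ρ : ℝ | 0 < ρ ∧ ∃ f : (Fin d → ℝ) → ℝ,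
    SmoothEnough f ∧ wnorm2 γ f ≤ ρ ^ 2 ∧ fvar f = 1}

theorem aux_dirichlet_lt (F F' : ℝ → ℝ) (hF : ∀ x, HasDerivAt F (F' x) x) (hc' : Continuous F')
    (h0 : F 0 = 0) (h1 : F 1 = 0) (c : ℝ) (hc0 : 0 < c) (hcpi : c < π) :
    c ^ 2 * ∫ x in (0:ℝ)..1, F x ^ 2 ≤ ∫ x in (0:ℝ)..1, F' x ^ 2 := by
  have hFc : Continuous F := continuous_iff_continuousAt.2 fun x => (hF x).continuousAt
  have hcos : ∀ x ∈ Set.Icc (0:ℝ) 1, 0 < Real.cos (c * (x - 1/2)) := by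
    intro x hx
    apply Real.cos_pos_of_mem_Ioo
    constructor <;> nlinarith [hx.1, hx.2]
  have hu : Set.uIcc (0:ℝ) 1 = Set.Icc 0 1 := Set.uIcc_of_le zero_le_one
  have hinner : ∀ x : ℝ, HasDerivAt (fun x : ℝ => c * (x - 1/2)) c x := by
    intro x
    have h := ((hasDerivAt_id x).sub_const (1/2)).const_mul c
    rw [mul_one] at h
    exact h
  have hd : ∀ x ∈ Set.uIcc (0:ℝ) 1, HasDerivAt (fun x => c * Real.tan (c * (x - 1/2)) * F x ^ 2)
      (c * (1 / Real.cos (c * (x - 1/2)) ^ 2 * c) * F x ^ 2 +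
        c * Real.tan (c * (x - 1/2)) * (2 * F x * F' x)) x := by
    intro x hx
    rw [hu] at hx
    have ht := ((Real.hasDerivAt_tan (hcos x hx).ne').comp x (hinner x)).const_mul c
    have h2 := (hF x).pow 2
    have h3 := ht.mul h2
    convert! h3 using 1
    simp [Function.comp]
  have hcontK : ContinuousOn (fun x => c * (1 / Real.cos (c * (x - 1/2)) ^ 2 * c) * F x ^ 2 +
        c * Real.tan (c * (x - 1/2)) * (2 * F x * F' x)) (Set.uIcc (0:ℝ) 1) := by
    rw [hu]
    have e : Set.EqOn (fun x => c * (1 / Real.cos (c * (x - 1/2)) ^ 2 * c) * F x ^ 2 +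
        c * Real.tan (c * (x - 1/2)) * (2 * F x * F' x))
        (fun x => c * (1 / Real.cos (c * (x - 1/2)) ^ 2 * c) * F x ^ 2 +
        c * (Real.sin (c * (x - 1/2)) / Real.cos (c * (x - 1/2))) * (2 * F x * F' x))
        (Set.Icc 0 1) := by
      intro x _
      simp only [Real.tan_eq_sin_div_cos]
    refine ContinuousOn.congr ?_ e
    have hk : ∀ x ∈ Set.Icc (0:ℝ) 1, Real.cos (c * (x - 1/2)) ≠ 0 := fun x hx => (hcos x hx).ne'
    have hk2 : ∀ x ∈ Set.Icc (0:ℝ) 1, Real.cos (c * (x - 1/2)) ^ 2 ≠ 0 :=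
      fun x hx => pow_ne_zero _ (hcos x hx).ne'
    have c1 : ContinuousOn (fun x : ℝ => Real.cos (c * (x - 1/2))) (Set.Icc 0 1) := by fun_prop
    have c2 : ContinuousOn (fun x : ℝ => Real.sin (c * (x - 1/2))) (Set.Icc 0 1) := by fun_prop
    have c3 := (continuousOn_const (c := (1:ℝ))).div (c1.pow 2) hk2
    have c4 := c2.div c1 hk
    have cF := hFc.continuousOn (s := Set.Icc (0:ℝ) 1)
    have cF' := hc'.continuousOn (s := Set.Icc (0:ℝ) 1)
    exact ((continuousOn_const.mul (c3.mul continuousOn_const)).mul (cF.pow 2)).add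
      ((continuousOn_const.mul c4).mul ((continuousOn_const.mul cF).mul cF'))
  have hint := intervalIntegral.integral_eq_sub_of_hasDerivAt hd hcontK.intervalIntegrable
  simp only [h0, h1] at hint
  have i1 : IntervalIntegrable (fun x => F x ^ 2) volume 0 1 :=
    (hFc.pow 2).intervalIntegrable _ _
  have i2 : IntervalIntegrable (fun x => F' x ^ 2) volume 0 1 :=
    (hc'.pow 2).intervalIntegrable _ _
  have hm := intervalIntegral.integral_mono_on (μ := volume) (zero_le_one (α := ℝ))
    ((i1.const_mul (c^2)).sub i2) hcontK.intervalIntegrable (by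
      intro x hx
      have hk := (hcos x hx).ne'
      have h1 : 1 / Real.cos (c * (x - 1/2)) ^ 2 = 1 + Real.tan (c * (x - 1/2)) ^ 2 := by
        rw [Real.tan_eq_sin_div_cos]
        generalize c * (x - 1/2) = y at hk
        field_simp
        linarith [Real.sin_sq_add_cos_sq y]
      rw [h1]
      nlinarith [sq_nonneg (F' x + c * Real.tan (c * (x - 1/2)) * F x)])
  rw [hint, intervalIntegral.integral_sub (i1.const_mul _) i2,
    intervalIntegral.integral_const_mul] at hm
  norm_num at hm
  linarith

theorem aux_dirichlet (F F' : ℝ → ℝ) (hF : ∀ x, HasDerivAt F (F' x) x) (hc' : Continuous F')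
    (h0 : F 0 = 0) (h1 : F 1 = 0) :
    π ^ 2 * ∫ x in (0:ℝ)..1, F x ^ 2 ≤ ∫ x in (0:ℝ)..1, F' x ^ 2 := by
  have ht : Filter.Tendsto (fun c : ℝ => c ^ 2 * ∫ x in (0:ℝ)..1, F x ^ 2)
      (nhdsWithin π (Set.Iio π)) (nhds (π ^ 2 * ∫ x in (0:ℝ)..1, F x ^ 2)) := by
    apply Filter.Tendsto.mono_left _ nhdsWithin_le_nhds
    apply Continuous.tendsto (f := fun c : ℝ => c ^ 2 * ∫ x in (0:ℝ)..1, F x ^ 2)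
    fun_prop
  refine le_of_tendsto ht ?_
  filter_upwards [Ioo_mem_nhdsLT Real.pi_pos] with c hc
  exact aux_dirichlet_lt F F' hF hc' h0 h1 c hc.1 hc.2

theorem aux_wirtinger (g g' : ℝ → ℝ) (hg : ∀ x, HasDerivAt g (g' x) x) (hc' : Continuous g')
    (hz : ∫ x in (0:ℝ)..1, g x = 0) :
    π ^ 2 * ∫ x in (0:ℝ)..1, g x ^ 2 ≤ ∫ x in (0:ℝ)..1, g' x ^ 2 := by
  have hgc : Continuous g := continuous_iff_continuousAt.2 fun x => (hg x).continuousAt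
  obtain ⟨F, hFdef⟩ : ∃ F : ℝ → ℝ, F = fun x => ∫ t in (0:ℝ)..x, g t := ⟨_, rfl⟩
  have hF : ∀ x, HasDerivAt F (g x) x := by
    intro x
    rw [hFdef]
    exact hgc.integral_hasStrictDerivAt 0 x |>.hasDerivAt
  have hFc : Continuous F := continuous_iff_continuousAt.2 fun x => (hF x).continuousAt
  have h0 : F 0 = 0 := by simp [hFdef]
  have h1 : F 1 = 0 := by simp [hFdef, hz]
  have hD := aux_dirichlet F g hF hgc h0 h1
  have hparts : ∫ x in (0:ℝ)..1, (g x * g x + F x * g' x) = 0 := by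
    rw [intervalIntegral.integral_eq_sub_of_hasDerivAt (f := fun x => F x * g x)
      (fun x _ => (hF x).mul (hg x)) (Continuous.intervalIntegrable (by fun_prop) _ _)]
    simp [h0, h1]
  have i1 : IntervalIntegrable (fun x => g x ^ 2) volume 0 1 :=
    Continuous.intervalIntegrable (by fun_prop) _ _
  have i2 : IntervalIntegrable (fun x => g' x ^ 2) volume 0 1 :=
    Continuous.intervalIntegrable (by fun_prop) _ _
  have i3 : IntervalIntegrable (fun x => F x ^ 2) volume 0 1 :=
    Continuous.intervalIntegrable (by fun_prop) _ _
  have i4 : IntervalIntegrable (fun x => g x * g x + F x * g' x) volume 0 1 :=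
    Continuous.intervalIntegrable (by fun_prop) _ _
  have hn : 0 ≤ ∫ x in (0:ℝ)..1, (g' x + π ^ 2 * F x) ^ 2 :=
    intervalIntegral.integral_nonneg zero_le_one fun x _ => sq_nonneg _
  have he : ∫ x in (0:ℝ)..1, (g' x + π ^ 2 * F x) ^ 2 =
      ∫ x in (0:ℝ)..1, (g' x ^ 2 + 2 * π ^ 2 * (g x * g x + F x * g' x)
        - 2 * π ^ 2 * g x ^ 2 + π ^ 4 * F x ^ 2) := by
    congr 1
    ext x
    ring
  rw [he, intervalIntegral.integral_add ((i2.add (i4.const_mul _)).sub (i1.const_mul _))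
      (i3.const_mul _),
    intervalIntegral.integral_sub (i2.add (i4.const_mul _)) (i1.const_mul _),
    intervalIntegral.integral_add i2 (i4.const_mul _)] at hn
  simp only [intervalIntegral.integral_const_mul] at hn
  rw [hparts] at hn
  nlinarith [mul_le_mul_of_nonneg_left hD (sq_nonneg π)]

/-- Differentiation under the integral sign. -/
theorem aux_diff_under (G h : ℝ → ℝ → ℝ) (hG : ∀ s t, HasDerivAt (fun s => G s t) (h s t) s)
    (hGc : ∀ s, Continuous (G s)) (hc : Continuous (Function.uncurry h)) (a b s₀ : ℝ) :
    HasDerivAt (fun s => ∫ t in a..b, G s t) (∫ t in a..b, h s₀ t) s₀ := by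
  obtain ⟨C, hC⟩ := ((isCompact_Icc (a := s₀ - 1) (b := s₀ + 1)).prod
    (isCompact_uIcc (a := a) (b := b))).exists_bound_of_continuousOn hc.continuousOn
  have hcs : Continuous (h s₀) := by
    have : h s₀ = Function.uncurry h ∘ (fun t => (s₀, t)) := rfl
    rw [this]
    fun_prop
  refine (intervalIntegral.hasDerivAt_integral_of_dominated_loc_of_deriv_le
    (bound := fun _ => C) (F := G) (F' := h)
    (s := Set.Icc (s₀ - 1) (s₀ + 1)) (Icc_mem_nhds (by linarith) (by linarith))
    (Filter.Eventually.of_forall fun s => (hGc s).aestronglyMeasurable)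
    ((hGc s₀).intervalIntegrable _ _) hcs.aestronglyMeasurable
    (Filter.Eventually.of_forall fun t ht s hs => ?_)
    intervalIntegrable_const
    (Filter.Eventually.of_forall fun t _ s _ => hG s t)).2
  exact hC (s, t) ⟨hs, Set.uIoc_subset_uIcc ht⟩

theorem aux_hasDeriv {d : ℕ} {j : Fin d} {g : (Fin d → ℝ) → ℝ}
    (hg : ∀ x, DifferentiableAt ℝ (fun t => g (Function.update x j t)) (x j))
    (x : Fin d → ℝ) (s : ℝ) :
    HasDerivAt (fun t => g (Function.update x j t)) (pderiv j g (Function.update x j s)) s := by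
  have := (hg (Function.update x j s)).hasDerivAt
  simpa [pderiv] using this

/-- Derivative of a one-coordinate average. -/
theorem aux_avg {d : ℕ} {k j : Fin d} (hkj : k ≠ j) {g : (Fin d → ℝ) → ℝ}
    (hg : ∀ x, DifferentiableAt ℝ (fun t => g (Function.update x k t)) (x k))
    (hgc : Continuous g) (hc : Continuous (pderiv k g)) (x : Fin d → ℝ) (a b s₀ : ℝ) :
    HasDerivAt (fun s => ∫ t in a..b, g (Function.update (Function.update x k s) j t))
      (∫ t in a..b, pderiv k g (Function.update (Function.update x k s₀) j t)) s₀ := by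
  refine aux_diff_under (fun s t => g (Function.update (Function.update x k s) j t))
    (fun s t => pderiv k g (Function.update (Function.update x k s) j t)) ?_ ?_ ?_ a b s₀
  · intro s t
    have := aux_hasDeriv hg (Function.update x j t) s
    simpa only [Function.update_comm hkj] using this
  · intro s
    fun_prop
  · simp only [Function.uncurry_def]
    fun_prop

theorem aux_schwarz {d : ℕ} {a b : Fin d} (hab : a ≠ b) {g : (Fin d → ℝ) → ℝ}
    (hga : ∀ x, DifferentiableAt ℝ (fun t => g (Function.update x a t)) (x a))
    (hgb : ∀ x, DifferentiableAt ℝ (fun t => g (Function.update x b t)) (x b))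
    (hgba : ∀ x, DifferentiableAt ℝ (fun t => pderiv b g (Function.update x a t)) (x a))
    (hcb : Continuous (pderiv b g)) (hc : Continuous (pderiv a (pderiv b g))) :
    pderiv b (pderiv a g) = pderiv a (pderiv b g) := by
  ext x
  have key : ∀ t, pderiv a g (Function.update x b t) = pderiv a g x +
      ∫ τ in (x b)..t, pderiv a (pderiv b g) (Function.update x b τ) := by
    intro t
    have h1 := aux_hasDeriv hga (Function.update x b t) (x a)
    have h2 := aux_hasDeriv hga x (x a)
    have h3 := aux_avg hab hgba hcb hc x (x b) t (x a)
    have h4 := h2.add h3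
    have e : (fun s => g (Function.update (Function.update x b t) a s)) =
        (fun s => g (Function.update x a s)) + fun s =>
          ∫ τ in (x b)..t, pderiv b g (Function.update (Function.update x a s) b τ) := by
      ext s
      have h5 := intervalIntegral.integral_eq_sub_of_hasDerivAt (a := x b) (b := t)
        (fun τ _ => aux_hasDeriv hgb (Function.update x a s) τ)
        (Continuous.intervalIntegrable (by fun_prop) _ _)
      rw [Pi.add_apply, h5, Function.update_comm hab.symm]
      have : Function.update (Function.update x a s) b (x b) = Function.update x a s := by
        rw [Function.update_eq_self_iff, Function.update_of_ne hab.symm]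
      rw [this]
      ring
    rw [e] at h1
    have h6 := h1.unique h4
    rw [Function.update_eq_self] at h6
    rw [← h6]
    congr 1
    symm
    rw [Function.update_eq_self_iff, Function.update_of_ne hab]
  have hcc : Continuous fun τ => pderiv a (pderiv b g) (Function.update x b τ) := by fun_prop
  have hd := ((hcc.integral_hasStrictDerivAt (x b) (x b)).hasDerivAt).const_add (pderiv a g x)
  have : pderiv b (pderiv a g) x =
    deriv (fun t => pderiv a g (Function.update x b t)) (x b) := rfl
  rw [this]
  simp only [key]
  rw [hd.deriv, Function.update_eq_self]

theorem aux_order {d : ℕ} {f : (Fin d → ℝ) → ℝ} (hsm : SmoothEnough f) (n : ℕ) :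
    ∀ l : List (Fin d), l.Nodup → l.length = n → l.foldr pderiv f = mderiv l.toFinset f := by
  induction n with
  | zero =>
    intro l _ hl
    rw [List.length_eq_zero_iff] at hl
    subst hl
    simp [mderiv]
  | succ n ih =>
    intro l hl hlen
    match l, hl, hlen with
    | b :: l', hl, hlen =>
    have hl' : l'.Nodup := (List.nodup_cons.1 hl).2
    have hb : b ∉ l' := (List.nodup_cons.1 hl).1
    have hlen' : l'.length = n := by simpa using hlen
    have hL := ih l' hl' hlen'
    rcases hv : (b :: l').toFinset.toList with _ | ⟨a, m⟩
    · simp at hv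
    have hnd := Finset.nodup_toList (b :: l').toFinset
    have hlenv : (b :: l').toFinset.toList.length = n + 1 := by
      rw [Finset.length_toList, List.toFinset_card_of_nodup hl, hlen]
    have hmem : ∀ i, i ∈ (b :: l').toFinset.toList ↔ i = b ∨ i ∈ l' := by
      intro i; simp
    rw [hv] at hnd hlenv hmem
    have hm : m.Nodup := (List.nodup_cons.1 hnd).2
    have ha : a ∉ m := (List.nodup_cons.1 hnd).1
    have hM := ih m hm (by simpa using hlenv)
    have e1 : mderiv (b :: l').toFinset f = pderiv a (mderiv m.toFinset f) := by
      rw [← hM]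
      unfold mderiv
      rw [hv]
      rfl
    rw [e1, List.foldr_cons, hL]
    simp only [List.mem_cons] at hmem
    by_cases hab : a = b
    · subst hab
      have : l'.toFinset = m.toFinset := by
        ext i
        simp only [List.mem_toFinset]
        have := hmem i
        by_cases hi : i = a
        · subst hi; tauto
        · tauto
      rw [this]
    · have hal : a ∈ l'.toFinset := by
        have := hmem a
        simp only [List.mem_toFinset]
        tauto
      have hbm : b ∈ m.toFinset := by
        have := hmem b
        simp only [List.mem_toFinset]
        have h2 : b ≠ a := fun h => hab h.symm
        tauto
      obtain ⟨w, hw⟩ : ∃ w, w = l'.toFinset.erase a := ⟨_, rfl⟩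
      have hw2 : w = m.toFinset.erase b := by
        rw [hw]
        ext i
        simp only [Finset.mem_erase, List.mem_toFinset]
        have := hmem i
        by_cases hi : i = a
        · subst hi; tauto
        · by_cases hi' : i = b
          · subst hi'; tauto
          · tauto
      have haw : a ∉ w := by simp [hw]
      have hbw : b ∉ w := by simp [hw2]
      have hcw : w.card + 1 = n := by
        rw [hw, Finset.card_erase_add_one hal, List.toFinset_card_of_nodup hl', hlen']
      have hA := ih (a :: w.toList) (by simp [haw, Finset.nodup_toList]) (by simp [hcw])
      have hB := ih (b :: w.toList) (by simp [hbw, Finset.nodup_toList]) (by simp [hcw])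
      have hA' : (a :: w.toList).toFinset = l'.toFinset := by
        rw [List.toFinset_cons, Finset.toList_toFinset, hw, Finset.insert_erase hal]
      have hB' : (b :: w.toList).toFinset = m.toFinset := by
        rw [List.toFinset_cons, Finset.toList_toFinset, hw2, Finset.insert_erase hbm]
      rw [hA'] at hA
      rw [hB'] at hB
      have hA2 : pderiv a (mderiv w f) = mderiv l'.toFinset f := hA
      have hB2 : pderiv b (mderiv w f) = mderiv m.toFinset f := hB
      rw [← hA2, ← hB2]
      refine aux_schwarz hab (hsm.1 w a) (hsm.1 w b) ?_ ?_ ?_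
      · rw [hB2]; exact hsm.1 _ a
      · rw [hB2]; exact hsm.2 _
      · rw [hB2, ← e1]; exact hsm.2 _

theorem aux_insert {d : ℕ} {f : (Fin d → ℝ) → ℝ} (hsm : SmoothEnough f) (v : Finset (Fin d))
    (j : Fin d) (hj : j ∉ v) : mderiv (insert j v) f = pderiv j (mderiv v f) := by
  have h := aux_order hsm _ (j :: v.toList) (by simp [hj, Finset.nodup_toList]) rfl
  rw [List.toFinset_cons, Finset.toList_toFinset] at h
  rw [← h]
  rfl

theorem aux_mean {d : ℕ} {f : (Fin d → ℝ) → ℝ} (hsm : SmoothEnough f)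
    (hmean : ∀ (j : Fin d) (x : Fin d → ℝ),
      ∫ t in (0:ℝ)..1, f (Function.update x j t) = 0) (v : Finset (Fin d)) :
    ∀ j ∉ v, ∀ x, ∫ t in (0:ℝ)..1, mderiv v f (Function.update x j t) = 0 := by
  induction v using Finset.induction_on with
  | empty =>
    intro j _ x
    simpa [mderiv] using hmean j x
  | insert k v hk ih =>
    intro j hj x
    have hjk : k ≠ j := by rintro rfl; simp at hj
    have hjv : j ∉ v := fun h => hj (Finset.mem_insert_of_mem h)
    have hins := aux_insert hsm v k hk
    have h := aux_avg hjk (hsm.1 v k) (hsm.2 v) (by rw [← hins]; exact hsm.2 _) x 0 1 (x k)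
    simp only [ih j hjv, Function.update_eq_self] at h
    rw [hins]
    exact h.unique (hasDerivAt_const _ _)

theorem aux_mp (d : ℕ) (j : Fin d) (ν : Measure ℝ) [IsProbabilityMeasure ν] :
    MeasurePreserving (fun p : (Fin d → ℝ) × ℝ => Function.update p.1 j p.2)
      ((Measure.pi fun _ : Fin d => ν).prod ν) (Measure.pi fun _ : Fin d => ν) := by
  have hmeas : Measurable (fun p : (Fin d → ℝ) × ℝ => Function.update p.1 j p.2) := by
    apply Continuous.measurable
    fun_prop
  refine ⟨hmeas, ?_⟩
  symm
  apply Measure.pi_eq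
  intro s hs
  rw [Measure.map_apply hmeas (MeasurableSet.univ_pi hs)]
  have : (fun p : (Fin d → ℝ) × ℝ => Function.update p.1 j p.2) ⁻¹' (Set.univ.pi s) =
      (Set.univ.pi (Function.update s j Set.univ)) ×ˢ s j := by
    ext p
    simp only [Set.mem_preimage, Set.mem_univ_pi, Set.mem_prod]
    constructor
    · intro h
      refine ⟨fun i => ?_, by simpa using h j⟩
      by_cases hi : i = j
      · subst hi; simp
      · simpa [hi] using h i
    · rintro ⟨h, h'⟩ i
      by_cases hi : i = j
      · subst hi; simpa using h'
      · simpa [hi] using h i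
  rw [this, Measure.prod_prod, Measure.pi_pi,
    ← Finset.mul_prod_erase Finset.univ (fun i => ν (s i)) (Finset.mem_univ j),
    ← Finset.mul_prod_erase Finset.univ (fun i => ν (Function.update s j Set.univ i))
      (Finset.mem_univ j), Function.update_self, measure_univ, one_mul, mul_comm]
  congr 1
  apply Finset.prod_congr rfl
  intro i hi
  rw [Function.update_of_ne (Finset.ne_of_mem_erase hi)]

theorem aux_cube (d : ℕ) : (volume : Measure (Fin d → ℝ)).restrict (cube d) =
    Measure.pi fun _ : Fin d => (volume : Measure ℝ).restrict (Set.Icc 0 1) := by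
  rw [cube, volume_pi, Measure.restrict_pi_pi]

theorem aux_prob : IsProbabilityMeasure ((volume : Measure ℝ).restrict (Set.Icc 0 1)) :=
  ⟨by simp⟩

theorem aux_compact (d : ℕ) : IsCompact (cube d) := isCompact_univ_pi fun _ => isCompact_Icc

theorem aux_fubini {d : ℕ} (j : Fin d) {φ : (Fin d → ℝ) → ℝ} (hφ : Continuous φ) :
    Integrable (fun x => ∫ t in (0:ℝ)..1, φ (Function.update x j t))
      (volume.restrict (cube d)) ∧
    ∫ x in cube d, φ x = ∫ x in cube d, ∫ t in (0:ℝ)..1, φ (Function.update x j t) := by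
  have := aux_prob
  have hi : Integrable φ (volume.restrict (cube d)) :=
    hφ.continuousOn.integrableOn_compact (aux_compact d)
  have hmp := aux_mp d j ((volume : Measure ℝ).restrict (Set.Icc 0 1))
  rw [← aux_cube] at hmp
  have hi2 := hmp.integrable_comp_of_integrable hi
  have e : ∀ x, ∫ t in (0:ℝ)..1, φ (Function.update x j t) =
      ∫ t in Set.Icc (0:ℝ) 1, φ (Function.update x j t) := by
    intro x
    rw [intervalIntegral.integral_of_le zero_le_one, integral_Icc_eq_integral_Ioc]
  simp only [e]
  refine ⟨hi2.integral_prod_left, ?_⟩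
  have h3 := integral_prod _ hi2
  simp only [Function.comp] at h3
  have h4 := integral_map (μ := (volume.restrict (cube d)).prod (volume.restrict (Set.Icc (0:ℝ) 1)))
    hmp.measurable.aemeasurable (f := φ) hφ.aestronglyMeasurable
  rw [hmp.map_eq] at h4
  rw [h4, h3]

theorem aux_step {d : ℕ} (j : Fin d) {g : (Fin d → ℝ) → ℝ}
    (hg : ∀ x, DifferentiableAt ℝ (fun t => g (Function.update x j t)) (x j))
    (hgc : Continuous g) (hc : Continuous (pderiv j g))
    (hz : ∀ x, ∫ t in (0:ℝ)..1, g (Function.update x j t) = 0) :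
    π ^ 2 * ∫ x in cube d, g x ^ 2 ≤ ∫ x in cube d, pderiv j g x ^ 2 := by
  obtain ⟨i1, e1⟩ := aux_fubini j (hgc.pow 2)
  obtain ⟨i2, e2⟩ := aux_fubini j (hc.pow 2)
  simp only [Pi.pow_apply] at i1 e1 i2 e2
  rw [e1, e2, ← integral_const_mul]
  refine integral_mono (i1.const_mul _) i2 fun x => ?_
  exact aux_wirtinger (fun t => g (Function.update x j t))
    (fun t => pderiv j g (Function.update x j t)) (aux_hasDeriv hg x) (by fun_prop) (hz x)

theorem aux_main {d : ℕ} {f : (Fin d → ℝ) → ℝ} (hsm : SmoothEnough f)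
    (hmean : ∀ (j : Fin d) (x : Fin d → ℝ),
      ∫ t in (0:ℝ)..1, f (Function.update x j t) = 0) (v : Finset (Fin d)) :
    π ^ (2 * v.card) * ∫ x in cube d, f x ^ 2 ≤ ∫ x in cube d, mderiv v f x ^ 2 := by
  induction v using Finset.induction_on with
  | empty => simp [mderiv]
  | insert k v hk ih =>
    have hins := aux_insert hsm v k hk
    have h := aux_step k (hsm.1 v k) (hsm.2 v) (by rw [← hins]; exact hsm.2 _)
      (aux_mean hsm hmean v k hk)
    rw [hins, Finset.card_insert_of_notMem hk]
    refine le_trans ?_ h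
    calc π ^ (2 * (v.card + 1)) * ∫ x in cube d, f x ^ 2
        = π ^ 2 * (π ^ (2 * v.card) * ∫ x in cube d, f x ^ 2) := by ring
      _ ≤ _ := mul_le_mul_of_nonneg_left ih (sq_nonneg π)

/-- Multidimensional Poincaré-type inequality (Lemma 2): if all one-dimensional
averages of `f : [0,1]^d → ℝ` vanish and `∂^{1:r} f` exists and is continuous, then
`∫ (∂^{1:r} f)² ≥ π^{2r} ∫ f²`. -/
theorem poincare_multidim (d r : ℕ) (hrd : r ≤ d) (f : (Fin d → ℝ) → ℝ)
    (hsm : SmoothEnough f)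
    (hmean : ∀ (j : Fin d) (x : Fin d → ℝ),
      ∫ t in (0:ℝ)..1, f (Function.update x j t) = 0) :
    ∫ x in cube d, (mderiv (Finset.univ.filter fun j : Fin d => (j : ℕ) < r) f x) ^ 2 ≥
      π ^ (2 * r) * ∫ x in cube d, (f x) ^ 2 := by
  have h := aux_main hsm hmean (Finset.univ.filter fun j : Fin d => (j : ℕ) < r)
  have hcard : (Finset.univ.filter fun j : Fin d => (j : ℕ) < r).card = r := by
    rw [Fin.card_filter_val_lt]
    exact min_eq_right hrd
  rw [hcard] at h
  exact h
end
end
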